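/- The map φ_# intertwines the deconcatenation coproduct on ℚ⟨Y^bi⟩ with the regularized coproduct on ℚ⟨B⟩⁰: one has (φ_# ⊗ φ_#) ∘ Δ_dec = Δ_dec⁰ ∘ φ_# as ℚ-linear maps ℚ⟨Y^bi⟩ → ℚ⟨B⟩⁰ ⊗_ℚ ℚ⟨B⟩⁰. -/

import Mathlib

/-!
STATEMENT 11: `(φ_# ⊗ φ_#) ∘ Δ_dec = Δ_dec⁰ ∘ φ_#` as maps `ℚ⟨Y^bi⟩ → ℚ⟨B⟩⁰ ⊗ ℚ⟨B⟩⁰`.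

`ℚ⟨Y^bi⟩` is realized as `List (ℕ × ℕ) →₀ ℚ`, the letter `y_{k,m}` (`k ≥ 1`) being
encoded as `(k-1, m)`; `ℚ⟨B⟩` is realized as `List ℕ →₀ ℚ`.  The map `φ_#` is given
by expanding its defining generating series (see statement 9).  `Δ_dec⁰` is
`(reg ⊗ reg) ∘ Δ_dec` on `ℚ⟨B⟩⁰`, where `reg` is the inverse of
`reg_T : ℚ⟨B⟩⁰[T] → ℚ⟨B⟩` followed by evaluation at `T = 0`.  The left-hand side
`(φ_# ⊗ φ_#)(Δ_dec x)` is written out on the expansion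
`Δ_dec x = ∑_w x_w ∑_{uv=w} u ⊗ v`.
-/

open Finsupp TensorProduct

/-- `ℚ⟨Y^bi⟩`; a letter `(a, m)` stands for `y_{a+1,m}`. -/
abbrev QY : Type := List (ℕ × ℕ) →₀ ℚ

/-- `ℚ⟨B⟩`. -/
abbrev QB : Type := List ℕ →₀ ℚ

/-- The word `y_{k₁,m₁} ⋯ y_{k_d,m_d}` of `ℚ⟨Y^bi⟩`. -/
noncomputable def wY (w : List (ℕ × ℕ)) : QY := Finsupp.single w 1

/-- The word `b_{s₁} ⋯ b_{s_l}` of `ℚ⟨B⟩`. -/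
noncomputable def wB (w : List ℕ) : QB := Finsupp.single w 1

/-- Left concatenation by the letter `b_a`, extended `ℚ`-linearly. -/
noncomputable def consB (a : ℕ) (x : QB) : QB := Finsupp.mapDomain (List.cons a) x

/-- The balanced quasi-shuffle product `∗_b` on words. -/
noncomputable def bshW : List ℕ → List ℕ → QB
  | [], w => wB w
  | i :: u, [] => wB (i :: u)
  | i :: u, j :: v =>
      consB i (bshW u (j :: v)) + consB j (bshW (i :: u) v) +
        (if 1 ≤ i ∧ 1 ≤ j then consB (i + j) (bshW u v) else 0)
  termination_by u v => u.length + v.length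

/-- The balanced quasi-shuffle product `∗_b` on `ℚ⟨B⟩` (ℚ-bilinear extension). -/
noncomputable def bsh (x y : QB) : QB :=
  x.sum fun u a => y.sum fun v b => (a * b) • bshW u v

/-- `ℚ⟨B⟩⁰`: the subspace of `ℚ⟨B⟩` spanned by `𝟏` and the words not starting in `b₀`. -/
noncomputable def QB0 : Submodule ℚ QB :=
  Submodule.span ℚ {x | ∃ w : List ℕ, w.head? ≠ some 0 ∧ x = wB w}

/-- The `n`-fold `∗_b`-power `b₀^{∗_b n}` of the letter `b₀`. -/
noncomputable def bpow : ℕ → QB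
  | 0 => wB []
  | n + 1 => bsh (bpow n) (wB [0])

/-- The regularization map `reg_T : ℚ⟨B⟩⁰[T] → ℚ⟨B⟩`, `w T^n ↦ w ∗_b b₀^{∗_b n}`. -/
noncomputable def regT (P : ℕ →₀ QB) : QB := P.sum fun n x => bsh x (bpow n)

instance : Nonempty {P : ℕ →₀ QB // ∀ n, P n ∈ QB0} :=
  ⟨⟨0, fun n => by simp [Submodule.zero_mem]⟩⟩

/-- The regularization `reg : ℚ⟨B⟩ → ℚ⟨B⟩⁰ ⊆ ℚ⟨B⟩`: the inverse of `reg_T` followed by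
evaluation at `T = 0`. -/
noncomputable def reg (x : QB) : QB :=
  ((Function.invFun (fun P : {P : ℕ →₀ QB // ∀ n, P n ∈ QB0} => regT P.1) x).1) 0

/-- The regularized coproduct `Δ_dec⁰ = (reg ⊗ reg) ∘ Δ_dec` on `ℚ⟨B⟩⁰ ⊆ ℚ⟨B⟩`. -/
noncomputable def dec0 (x : QB) : QB ⊗[ℚ] QB :=
  x.sum fun w a =>
    a • ∑ i ∈ Finset.range (w.length + 1),
      (reg (wB (w.take i))) ⊗ₜ[ℚ] (reg (wB (w.drop i)))

/-- The set of matrices `c` (given by their columns `c j : Fin d → ℕ`) with column sums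
`∑_i c j i = m j` and vanishing strictly above the diagonal. -/
noncomputable def matSet (d : ℕ) (m : Fin d → ℕ) : Finset (Fin d → Fin d → ℕ) :=
  (Fintype.piFinset fun j : Fin d => Finset.Nat.antidiagonalTuple d (m j)).filter
    fun c => ∀ i j : Fin d, i < j → c j i = 0

/-- `φ_#` on the word with letters `y_{(w i).1 + 1, (w i).2}`. -/
noncomputable def phiW (w : List (ℕ × ℕ)) : QB :=
  ∑ c ∈ matSet w.length fun j => (w.get j).2,
    ((∏ j : Fin w.length, (((w.get j).2).factorial : ℚ)) *
        ∏ i : Fin w.length, (Nat.multinomial Finset.univ (fun j => c j i) : ℚ)) •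
      wB ((List.ofFn fun i : Fin w.length =>
        ((w.get i).1 + 1) :: List.replicate (∑ j : Fin w.length, c j i) 0).flatten)

/-- The map `φ_# : ℚ⟨Y^bi⟩ → ℚ⟨B⟩⁰ ⊆ ℚ⟨B⟩` (ℚ-linear extension). -/
noncomputable def phi (x : QY) : QB := x.sum fun w a => a • phiW w


/-! ### Linear versions of the operators -/

/-- left concatenation by a letter, as a linear map -/
noncomputable def conL (a : ℕ) : QB →ₗ[ℚ] QB := Finsupp.lmapDomain ℚ ℚ (List.cons a)

theorem consB_eq (a : ℕ) (x : QB) : consB a x = conL a x := rfl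

theorem conL_wB (a : ℕ) (w : List ℕ) : conL a (wB w) = wB (a :: w) := by
  simp [conL, wB]

theorem QB_ext {V : Type*} [AddCommMonoid V] [Module ℚ V] {f g : QB →ₗ[ℚ] V}
    (h : ∀ w, f (wB w) = g (wB w)) : f = g := by
  apply Finsupp.lhom_ext
  intro w b
  have : (Finsupp.single w b : QB) = b • wB w := by simp [wB]
  rw [this, map_smul, map_smul, h]

/-- linear extension of a map on words -/
noncomputable def extB {V : Type*} [AddCommMonoid V] [Module ℚ V] (f : List ℕ → V) :
    QB →ₗ[ℚ] V := Finsupp.linearCombination ℚ f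

theorem extB_wB {V : Type*} [AddCommMonoid V] [Module ℚ V] (f : List ℕ → V) (w : List ℕ) :
    extB f (wB w) = f w := by
  simp [extB, wB]

/-- insertion of the letter `b₀` on words -/
noncomputable def MW : List ℕ → QB
  | [] => wB [0]
  | i :: u => conL i (MW u) + wB (0 :: i :: u)

/-- the product with `b₀` -/
noncomputable def M : QB →ₗ[ℚ] QB := extB MW

theorem M_nil : M (wB []) = wB [0] := by rw [M, extB_wB, MW]

theorem M_con (i : ℕ) (x : QB) : M (conL i x) = conL i (M x) + conL 0 (conL i x) := by
  have : M ∘ₗ conL i = conL i ∘ₗ M + conL 0 ∘ₗ conL i := by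
    apply QB_ext
    intro w
    simp [conL_wB, M, extB_wB, MW]
  simpa using LinearMap.congr_fun this x

/-- bilinear version of `bsh` -/
noncomputable def bshL : QB →ₗ[ℚ] QB →ₗ[ℚ] QB := extB fun u => extB fun v => bshW u v

theorem bsh_eq (x y : QB) : bsh x y = bshL x y := by
  simp only [bsh, bshL, extB, Finsupp.linearCombination_apply, Finsupp.sum, LinearMap.sum_apply,
    LinearMap.smul_apply, Finset.smul_sum, smul_smul]

theorem bshL_wB (u v : List ℕ) : bshL (wB u) (wB v) = bshW u v := by
  simp [bshL, extB_wB]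

theorem bshL_nil_left (x : QB) : bshL (wB []) x = x := by
  have : bshL (wB []) = LinearMap.id := by
    apply QB_ext; intro w; simp [bshL_wB, bshW]
  rw [this]; rfl

theorem bshL_nil_right (x : QB) : bshL x (wB []) = x := by
  have : bshL.flip (wB []) = LinearMap.id := by
    apply QB_ext; intro w; cases w <;> simp [bshL_wB, bshW]
  exact LinearMap.congr_fun this x

theorem bshL_con (i j : ℕ) (x y : QB) : bshL (conL i x) (conL j y) =
    conL i (bshL x (conL j y)) + conL j (bshL (conL i x) y) +
      (if 1 ≤ i ∧ 1 ≤ j then conL (i + j) (bshL x y) else 0) := by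
  have : (bshL.compl₂ (conL j)) ∘ₗ conL i =
      (bshL.compl₂ (conL j)).compr₂ (conL i) + (bshL ∘ₗ conL i).compr₂ (conL j) +
      (if 1 ≤ i ∧ 1 ≤ j then bshL.compr₂ (conL (i + j)) else 0) := by
    apply QB_ext; intro u; apply QB_ext; intro v
    split_ifs with h <;> simp [conL_wB, bshL_wB, bshW, consB_eq, h]
  have := LinearMap.congr_fun (LinearMap.congr_fun this x) y
  split_ifs at this ⊢ with h <;> simpa using this

theorem bshL_zero (x : QB) : bshL x (wB [0]) = M x := by
  have : bshL.flip (wB [0]) = M := by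
    apply QB_ext; intro w
    induction w with
    | nil => simp [bshL_wB, bshW, M_nil]
    | cons i u ih =>
      have h0 : wB [0] = conL 0 (wB []) := by rw [conL_wB]
      rw [← conL_wB i, M_con, ← ih]
      simp only [LinearMap.flip_apply]
      rw [h0, bshL_con]
      simp [bshL_nil_right]
  exact LinearMap.congr_fun this x

theorem bshL_M_wB (u v : List ℕ) : bshL (wB u) (M (wB v)) = M (bshL (wB u) (wB v)) := by
  induction u generalizing v with
  | nil => simp [bshL_nil_left]
  | cons i u ihu =>
    induction v with
    | nil => rw [M_nil, bshL_zero, bshL_nil_right]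
    | cons j v ihv =>
      have h1 := ihu (j :: v)
      have h2 := ihu v
      rw [← conL_wB j] at *
      rw [← conL_wB i] at *
      rw [M_con, map_add, bshL_con i 0, bshL_con i j, bshL_con i j]
      rw [M_con, map_add] at h1
      simp only [map_add, M_con, ← h1, ← ihv]
      split_ifs with h h' h' <;> simp [M_con, h2] at * <;> abel

theorem bshL_M (x y : QB) : bshL x (M y) = M (bshL x y) := by
  have : bshL.compl₂ M = bshL.compr₂ M := by
    apply QB_ext; intro u; apply QB_ext; intro v
    exact bshL_M_wB u v
  exact LinearMap.congr_fun (LinearMap.congr_fun this x) y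

theorem bshL_bpow (x : QB) (n : ℕ) : bshL x (bpow n) = (M ^ n) x := by
  induction n with
  | zero => simp [bpow, bshL_nil_right]
  | succ n ih => rw [bpow, bsh_eq, bshL_zero, bshL_M, ih, pow_succ']; rfl

theorem regT_eq (P : ℕ →₀ QB) : regT P = P.sum fun n x => (M ^ n) x := by
  simp only [regT, bsh_eq, bshL_bpow]

/-! ### The regularization -/

/-- insertion of `b₀` after the first letter, on words -/
noncomputable def MpW : List ℕ → QB
  | [] => 0
  | i :: u => conL i (M (wB u))

/-- insertion of `b₀` after the first letter -/
noncomputable def Mp : QB →ₗ[ℚ] QB := extB MpW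

theorem Mp_nil : Mp (wB []) = 0 := by rw [Mp, extB_wB, MpW]

theorem Mp_con (i : ℕ) (x : QB) : Mp (conL i x) = conL i (M x) := by
  have : Mp ∘ₗ conL i = conL i ∘ₗ M := by
    apply QB_ext; intro w; simp [conL_wB, Mp, extB_wB, MpW]
  exact LinearMap.congr_fun this x

theorem M_eq (x : QB) : M x = conL 0 x + Mp x := by
  have : M = conL 0 + Mp := by
    apply QB_ext; intro w
    cases w with
    | nil => simp [M_nil, Mp_nil, conL_wB]
    | cons i u => simp only [LinearMap.add_apply]; rw [← conL_wB, M_con, Mp_con, add_comm]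
  exact LinearMap.congr_fun this x

/-- explicit regularization on words, with `n` leading zeros already removed -/
noncomputable def rhoW : ℕ → List ℕ → QB
  | n, [] => if n = 0 then wB [] else 0
  | n, 0 :: u => rhoW (n + 1) u
  | n, (k + 1) :: u => ((-1 : ℚ) ^ n / n.factorial) • conL (k + 1) ((M ^ n) (wB u))

/-- explicit regularization -/
noncomputable def rho (n : ℕ) : QB →ₗ[ℚ] QB := extB (rhoW n)

theorem rho_con_zero (n : ℕ) (x : QB) : rho n (conL 0 x) = rho (n + 1) x := by
  have : rho n ∘ₗ conL 0 = rho (n + 1) := by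
    apply QB_ext; intro w; simp [conL_wB, rho, extB_wB, rhoW]
  exact LinearMap.congr_fun this x

theorem rho_con_succ (n k : ℕ) (x : QB) : rho n (conL (k + 1) x) =
    ((-1 : ℚ) ^ n / n.factorial) • conL (k + 1) ((M ^ n) x) := by
  have : rho n ∘ₗ conL (k + 1) =
      ((-1 : ℚ) ^ n / n.factorial) • (conL (k + 1) ∘ₗ (M ^ n)) := by
    apply QB_ext; intro w; simp [conL_wB, rho, extB_wB, rhoW]
  exact LinearMap.congr_fun this x

theorem rho_M_wB (n : ℕ) (w : List ℕ) : rho n (M (wB w)) = -(n : ℚ) • rho (n + 1) (wB w) := by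
  induction w generalizing n with
  | nil => simp [M_nil, rho, extB_wB, rhoW]
  | cons i u ih =>
    rw [← conL_wB, M_con, map_add]
    cases i with
    | zero =>
      simp only [rho_con_zero, ih]
      push_cast
      module
    | succ k =>
      rw [rho_con_zero, rho_con_succ, rho_con_succ, pow_succ M]
      simp only [Module.End.mul_apply, smul_smul]
      rw [← add_smul]
      congr 1
      rw [Nat.factorial_succ]
      have : (n.factorial : ℚ) ≠ 0 := by positivity
      have : (n : ℚ) + 1 ≠ 0 := by positivity
      push_cast
      field_simp
      ring

theorem rho_M (x : QB) : rho 0 (M x) = 0 := by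
  have : rho 0 ∘ₗ M = 0 := by
    apply QB_ext; intro w; simp [rho_M_wB]
  exact LinearMap.congr_fun this x

theorem nil_mem : wB [] ∈ QB0 := Submodule.subset_span ⟨[], by simp, rfl⟩

theorem con_mem (k : ℕ) (x : QB) : conL (k + 1) x ∈ QB0 := by
  have : QB0.mkQ ∘ₗ conL (k + 1) = 0 := by
    apply QB_ext; intro w
    simp only [LinearMap.comp_apply, conL_wB, LinearMap.zero_apply, Submodule.mkQ_apply,
      Submodule.Quotient.mk_eq_zero]
    exact Submodule.subset_span ⟨_, by simp, rfl⟩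
  simpa using LinearMap.congr_fun this x

theorem rho_id {x : QB} (hx : x ∈ QB0) : rho 0 x = x := by
  induction hx using Submodule.span_induction with
  | mem x h =>
    obtain ⟨w, hw, rfl⟩ := h
    match w with
    | [] => simp [rho, extB_wB, rhoW]
    | 0 :: u => simp at hw
    | (k + 1) :: u => rw [← conL_wB, rho_con_succ]; simp
  | zero => simp
  | add x y _ _ h1 h2 => rw [map_add, h1, h2]
  | smul a x _ h => rw [map_smul, h]

theorem rho_regT (P : ℕ →₀ QB) (hP : ∀ n, P n ∈ QB0) : rho 0 (regT P) = P 0 := by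
  rw [regT_eq, Finsupp.sum, map_sum, Finset.sum_eq_single 0]
  · simp [rho_id (hP 0)]
  · intro n _ hn
    obtain ⟨k, rfl⟩ := Nat.exists_eq_succ_of_ne_zero hn
    rw [pow_succ', Module.End.mul_apply, rho_M]
  · intro h
    simp only [Finsupp.mem_support_iff, not_not] at h
    simp [h]

/-- the range of `reg_T` -/
noncomputable def rangeT : Submodule ℚ QB := ⨆ n : ℕ, QB0.map (M ^ n)

theorem rangeT_le {x : QB} (hx : x ∈ rangeT) : ∃ P : ℕ →₀ QB, (∀ n, P n ∈ QB0) ∧ regT P = x := by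
  induction hx using Submodule.iSup_induction' with
  | mem n x h =>
    obtain ⟨y, hy, rfl⟩ := h
    refine ⟨Finsupp.single n y, fun m => ?_, ?_⟩
    · classical
      rw [Finsupp.single_apply]
      split_ifs
      · exact hy
      · exact Submodule.zero_mem _
    · rw [regT_eq, Finsupp.sum_single_index (by simp)]
  | zero => exact ⟨0, fun n => by simp [Submodule.zero_mem], by simp [regT_eq]⟩
  | add x y _ _ h1 h2 =>
    obtain ⟨P, hP, rfl⟩ := h1
    obtain ⟨Q, hQ, rfl⟩ := h2
    refine ⟨P + Q, fun n => Submodule.add_mem _ (hP n) (hQ n), ?_⟩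
    simp only [regT_eq]
    rw [Finsupp.sum_add_index'] <;> simp

theorem rangeT_M {x : QB} (hx : x ∈ rangeT) : M x ∈ rangeT := by
  have : rangeT ≤ rangeT.comap M := by
    refine iSup_le fun n => ?_
    rintro _ ⟨y, hy, rfl⟩
    refine Submodule.mem_iSup_of_mem (n + 1) ⟨y, hy, ?_⟩
    rw [pow_succ']; rfl
  exact this hx

theorem Mp_mem {x : QB} (hx : x ∈ QB0) : Mp x ∈ QB0 := by
  have : QB0 ≤ QB0.comap Mp := by
    refine Submodule.span_le.2 ?_
    rintro _ ⟨w, hw, rfl⟩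
    match w with
    | [] => simp [Mp_nil]
    | 0 :: u => simp at hw
    | (k + 1) :: u =>
      simp only [SetLike.mem_coe, Submodule.mem_comap]
      rw [← conL_wB, Mp_con]; exact con_mem _ _
  exact this hx

theorem M_con0_pow (n : ℕ) (x : QB) :
    M ((conL 0 ^ n) x) = (n : ℚ) • (conL 0 ^ (n + 1)) x + (conL 0 ^ n) (M x) := by
  induction n with
  | zero => simp
  | succ n ih =>
    rw [pow_succ', Module.End.mul_apply, M_con, ih, pow_succ' _ (n + 1), pow_succ' _ n]
    simp only [Module.End.mul_apply, map_add, map_smul]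
    push_cast
    module

theorem con0_pow_mem (n : ℕ) {x : QB} (hx : x ∈ QB0) : (conL 0 ^ n) x ∈ rangeT := by
  induction n generalizing x with
  | zero => exact Submodule.mem_iSup_of_mem 0 ⟨x, hx, rfl⟩
  | succ n ih =>
    have h1 := rangeT_M (ih hx)
    have h2 := ih (Mp_mem hx)
    rw [M_con0_pow, M_eq x, map_add, ← Module.End.mul_apply, ← pow_succ] at h1
    have h3 := rangeT.smul_mem ((n + 1 : ℚ)⁻¹) (rangeT.sub_mem h1 h2)
    convert h3 using 1
    have : (n : ℚ) + 1 ≠ 0 := by positivity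
    rw [show (n : ℚ) • (conL 0 ^ (n + 1)) x + ((conL 0 ^ (n + 1)) x + (conL 0 ^ n) (Mp x)) -
      (conL 0 ^ n) (Mp x) = ((n : ℚ) + 1) • (conL 0 ^ (n + 1)) x by module, smul_smul,
      inv_mul_cancel₀ this, one_smul]

theorem wB_mem_rangeT (w : List ℕ) (n : ℕ) : (conL 0 ^ n) (wB w) ∈ rangeT := by
  induction w generalizing n with
  | nil => exact con0_pow_mem n nil_mem
  | cons i u ih =>
    rw [← conL_wB]
    cases i with
    | zero => rw [← Module.End.mul_apply, ← pow_succ]; exact ih _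
    | succ k => exact con0_pow_mem n (con_mem _ _)

theorem mem_rangeT (x : QB) : x ∈ rangeT := by
  have : rangeT.mkQ = 0 := by
    apply QB_ext; intro w
    simpa using wB_mem_rangeT w 0
  simpa using LinearMap.congr_fun this x

theorem reg_eq (x : QB) : reg x = rho 0 x := by
  obtain ⟨P, hP, hx⟩ := rangeT_le (mem_rangeT x)
  have h := Function.invFun_eq
    (f := fun P : {P : ℕ →₀ QB // ∀ n, P n ∈ QB0} => regT P.1) (b := x) ⟨⟨P, hP⟩, hx⟩
  set Q := Function.invFun (fun P : {P : ℕ →₀ QB // ∀ n, P n ∈ QB0} => regT P.1) x with hQ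
  have h2 := rho_regT Q.1 Q.2
  have h' : regT Q.1 = x := h
  rw [h'] at h2
  rw [h2]
  rfl

/-! ### Deconcatenation -/

/-- deconcatenation on `ℚ⟨B⟩` -/
noncomputable def D : QB →ₗ[ℚ] QB ⊗[ℚ] QB := extB fun w =>
  ∑ i ∈ Finset.range (w.length + 1), (wB (w.take i)) ⊗ₜ[ℚ] (wB (w.drop i))

theorem dec0_eq (x : QB) : dec0 x = TensorProduct.map (rho 0) (rho 0) (D x) := by
  have : TensorProduct.map (rho 0) (rho 0) ∘ₗ D = extB fun w =>
      ∑ i ∈ Finset.range (w.length + 1),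
      (reg (wB (w.take i))) ⊗ₜ[ℚ] (reg (wB (w.drop i))) := by
    apply QB_ext; intro w
    simp [D, extB_wB, reg_eq]
  rw [← LinearMap.comp_apply, this]
  simp [dec0, extB, Finsupp.linearCombination_apply]

theorem D_nil : D (wB []) = wB [] ⊗ₜ[ℚ] wB [] := by simp [D, extB_wB]

theorem D_con (k : ℕ) (x : QB) :
    D (conL k x) = wB [] ⊗ₜ[ℚ] conL k x + (conL k).rTensor QB (D x) := by
  have : D ∘ₗ conL k = TensorProduct.mk ℚ QB QB (wB []) ∘ₗ conL k + (conL k).rTensor QB ∘ₗ D := by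
    apply QB_ext; intro w
    simp only [LinearMap.comp_apply, LinearMap.add_apply, conL_wB, D, extB_wB, map_sum,
      LinearMap.rTensor_tmul, List.length_cons]
    rw [Finset.sum_range_succ' _ (w.length + 1)]
    simp [add_comm]
  simpa using LinearMap.congr_fun this x

theorem D_M (x : QB) : D (M x) = M.rTensor QB (D x) + M.lTensor QB (D x) := by
  have : D ∘ₗ M = M.rTensor QB ∘ₗ D + M.lTensor QB ∘ₗ D := by
    apply QB_ext; intro w
    induction w with
    | nil =>
      have h0 : wB [0] = conL 0 (wB []) := by rw [conL_wB]
      simp only [LinearMap.comp_apply, LinearMap.add_apply, M_nil, D_nil,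
        LinearMap.rTensor_tmul, LinearMap.lTensor_tmul]
      rw [h0, D_con, D_nil]
      simp [add_comm]
    | cons i u ih =>
      simp only [LinearMap.comp_apply, LinearMap.add_apply] at ih ⊢
      rw [← conL_wB, M_con, map_add, D_con, D_con, D_con, ih]
      have e1 : ∀ t : QB ⊗[ℚ] QB, M.rTensor QB ((conL i).rTensor QB t) =
          (conL i).rTensor QB (M.rTensor QB t) +
          (conL 0).rTensor QB ((conL i).rTensor QB t) := by
        intro t
        induction t with
        | zero => simp
        | tmul a b => simp [M_con, TensorProduct.add_tmul]
        | add a b ha hb => simp only [map_add, ha, hb]; abel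
      have e2 : ∀ t : QB ⊗[ℚ] QB, M.lTensor QB ((conL i).rTensor QB t) =
          (conL i).rTensor QB (M.lTensor QB t) := by
        intro t
        induction t with
        | zero => simp
        | tmul a b => simp
        | add a b ha hb => simp only [map_add, ha, hb]
      have h0 : wB [0] = conL 0 (wB []) := by rw [conL_wB]
      simp only [map_add, e1, e2, LinearMap.rTensor_tmul, LinearMap.lTensor_tmul, M_con, M_nil,
        TensorProduct.tmul_add, h0]
      abel
  exact LinearMap.congr_fun this x

theorem D_M_pow (n : ℕ) (x : QB) :
    (rho 0).lTensor QB (D ((M ^ n) x)) = (M ^ n).rTensor QB ((rho 0).lTensor QB (D x)) := by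
  have e1 : ∀ t : QB ⊗[ℚ] QB, (rho 0).lTensor QB (M.lTensor QB t) = 0 := by
    intro t
    induction t with
    | zero => simp
    | tmul a b => simp [rho_M]
    | add a b ha hb => simp only [map_add, ha, hb, add_zero]
  have e2 : ∀ t : QB ⊗[ℚ] QB, (rho 0).lTensor QB (M.rTensor QB t) =
      M.rTensor QB ((rho 0).lTensor QB t) := by
    intro t
    induction t with
    | zero => simp
    | tmul a b => simp
    | add a b ha hb => simp only [map_add, ha, hb]
  induction n with
  | zero => simp [Module.End.one_eq_id]
  | succ n ih =>
    rw [pow_succ', Module.End.mul_apply, D_M, map_add, e1, e2, ih, add_zero,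
      Module.End.mul_eq_comp, LinearMap.rTensor_comp]
    rfl

/-! ### The recursion for `φ_#` -/

/-- Recursive version of `φ_#` -/
noncomputable def psi : List (ℕ × ℕ) → QB
  | [] => wB []
  | p :: w => conL (p.1 + 1) ((M ^ p.2) (psi w))

theorem psi_mem (w : List (ℕ × ℕ)) : psi w ∈ QB0 := by
  cases w with
  | nil => exact nil_mem
  | cons p w => exact con_mem _ _

theorem D_psi (w : List (ℕ × ℕ)) : (rho 0).lTensor QB (D (psi w)) =
    ∑ i ∈ Finset.range (w.length + 1), (psi (w.take i)) ⊗ₜ[ℚ] (psi (w.drop i)) := by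
  induction w with
  | nil => simp [psi, D_nil, rho_id nil_mem]
  | cons p w ih =>
    have e2 : ∀ t : QB ⊗[ℚ] QB, (rho 0).lTensor QB ((conL (p.1 + 1)).rTensor QB t) =
        (conL (p.1 + 1)).rTensor QB ((rho 0).lTensor QB t) := by
      intro t
      induction t with
      | zero => simp
      | tmul a b => simp
      | add a b ha hb => simp only [map_add, ha, hb]
    rw [List.length_cons, Finset.sum_range_succ' _ (w.length + 1)]
    rw [psi, D_con, map_add, e2, D_M_pow, ih, LinearMap.lTensor_tmul, rho_id (con_mem _ _)]
    simp [psi, add_comm]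

theorem dec0_psi (w : List (ℕ × ℕ)) : dec0 (psi w) =
    ∑ i ∈ Finset.range (w.length + 1), (psi (w.take i)) ⊗ₜ[ℚ] (psi (w.drop i)) := by
  have h : TensorProduct.map (rho 0) (rho 0) = (rho 0).rTensor QB ∘ₗ (rho 0).lTensor QB := by
    rw [LinearMap.rTensor_comp_lTensor]
  rw [dec0_eq, h, LinearMap.comp_apply, D_psi, map_sum]
  refine Finset.sum_congr rfl fun i _ => ?_
  rw [LinearMap.rTensor_tmul, rho_id (psi_mem _)]

/-- the word `b_{k₁}b₀^{a₁}⋯` -/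
def wrd (d : ℕ) (k a : Fin d → ℕ) : List ℕ :=
  (List.ofFn fun i : Fin d => (k i + 1) :: List.replicate (a i) 0).flatten

theorem wrd_succ (d : ℕ) (k a : Fin (d + 1) → ℕ) : wrd (d + 1) k a =
    (k 0 + 1) :: (List.replicate (a 0) 0 ++ wrd d (fun i => k i.succ) (fun i => a i.succ)) := by
  simp [wrd, List.ofFn_succ]

theorem con0_pow_wB (n : ℕ) (w : List ℕ) :
    (conL 0 ^ n) (wB w) = wB (List.replicate n 0 ++ w) := by
  induction n with
  | zero => simp
  | succ n ih => rw [pow_succ', Module.End.mul_apply, ih, conL_wB]; rfl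

theorem M_pow_nil (m a : ℕ) : (M ^ m) ((conL 0 ^ a) (wB [])) =
    ((m.factorial * (a + m).choose m : ℕ) : ℚ) • (conL 0 ^ (a + m)) (wB []) := by
  induction m with
  | zero => simp
  | succ m ih =>
    have e : M (wB []) = conL 0 (wB []) := by rw [M_nil, conL_wB]
    rw [pow_succ', Module.End.mul_apply, ih, map_smul, M_con0_pow, e, ← Module.End.mul_apply,
      ← pow_succ, ← add_assoc a m 1]
    have h : (a + m + 1).choose (m + 1) * (m + 1) = (a + m + 1) * (a + m).choose m :=
      (Nat.add_one_mul_choose_eq (a + m) m).symm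
    have h' : (((a + m + 1).choose (m + 1) : ℕ) : ℚ) * (m + 1) =
      (a + m + 1) * (((a + m).choose m : ℕ) : ℚ) := by exact_mod_cast h
    rw [Nat.factorial_succ]
    rw [← one_smul ℚ ((conL 0 ^ (a + m + 1)) (wB [])), smul_smul, ← add_smul, smul_smul]
    simp only [smul_smul]
    congr 1
    push_cast
    linear_combination (-(m.factorial : ℚ)) * h'

theorem M_pow_con (m a k : ℕ) (x : QB) : (M ^ m) ((conL 0 ^ a) (conL k x)) =
    ∑ pq ∈ Finset.HasAntidiagonal.antidiagonal m,
      ((m.choose pq.1 * (pq.1.factorial * (a + pq.1).choose pq.1) : ℕ) : ℚ) •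
        (conL 0 ^ (a + pq.1)) (conL k ((M ^ pq.2) x)) := by
  let T : ℕ → ℕ → QB := fun p q => ((p.factorial * (a + p).choose p : ℕ) : ℚ) •
        (conL 0 ^ (a + p)) (conL k ((M ^ q) x))
  have hT : ∀ p q, M (T p q) = T p (q + 1) + T (p + 1) q := by
    intro p q
    simp only [T]
    rw [map_smul, M_con0_pow, M_con, map_add, ← Module.End.mul_apply _ (conL 0), ← pow_succ,
      pow_succ' M, Module.End.mul_apply, ← add_assoc a p 1]
    have h : (a + p + 1).choose (p + 1) * (p + 1) = (a + p + 1) * (a + p).choose p :=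
      (Nat.add_one_mul_choose_eq (a + p) p).symm
    have h' : (((p + 1).factorial * (a + p + 1).choose (p + 1) : ℕ) : ℚ) =
      (a + p + 1) * ((p.factorial * (a + p).choose p : ℕ) : ℚ) := by
      rw [Nat.factorial_succ]
      norm_cast
      linear_combination (p.factorial) * h
    rw [h']
    push_cast
    module
  have key : (M ^ m) (T 0 0) = ∑ pq ∈ Finset.HasAntidiagonal.antidiagonal m, m.choose pq.1 • T pq.1 pq.2 := by
    induction m with
    | zero => simp
    | succ m ih =>
      rw [pow_succ', Module.End.mul_apply, ih, Finset.sum_antidiagonal_choose_succ_nsmul, map_sum,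
        ← Finset.sum_add_distrib]
      refine Finset.sum_congr rfl fun pq hpq => ?_
      rw [map_nsmul, hT, smul_add]
      congr 2
      rw [Finset.HasAntidiagonal.mem_antidiagonal] at hpq
      exact Nat.choose_symm_of_eq_add hpq.symm
  have h0 : T 0 0 = (conL 0 ^ a) (conL k x) := by simp [T]
  rw [← h0, key]
  refine Finset.sum_congr rfl fun pq _ => ?_
  simp only [T]
  rw [← Nat.cast_smul_eq_nsmul ℚ, smul_smul]
  push_cast
  rfl

theorem sum_tuple_succ {V : Type*} [AddCommMonoid V] (d m : ℕ) (F : (Fin (d + 1) → ℕ) → V) :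
    ∑ e ∈ Finset.Nat.antidiagonalTuple (d + 1) m, F e =
    ∑ pq ∈ Finset.HasAntidiagonal.antidiagonal m, ∑ e ∈ Finset.Nat.antidiagonalTuple d pq.2,
      F (Fin.cons pq.1 e) := by
  rw [Finset.sum_sigma']
  refine Finset.sum_bij' (fun e _ => ⟨(e 0, ∑ i : Fin d, e i.succ), fun i => e i.succ⟩)
    (fun x _ => Fin.cons x.1.1 x.2) ?_ ?_ ?_ ?_ ?_
  · intro e he
    rw [Finset.Nat.mem_antidiagonalTuple, Fin.sum_univ_succ] at he
    simp [Finset.Nat.mem_antidiagonalTuple, he]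
  · rintro ⟨⟨p, q⟩, e⟩ h
    simp only [Finset.mem_sigma, Finset.HasAntidiagonal.mem_antidiagonal, Finset.Nat.mem_antidiagonalTuple] at h
    simp [Finset.Nat.mem_antidiagonalTuple, Fin.sum_univ_succ, h]
  · intro e _
    funext i
    refine Fin.cases ?_ (fun i => ?_) i <;> simp
  · rintro ⟨⟨p, q⟩, e⟩ h
    simp only [Finset.mem_sigma, Finset.HasAntidiagonal.mem_antidiagonal, Finset.Nat.mem_antidiagonalTuple] at h
    simp [h]
  · intro e _
    congr 1
    funext i
    refine Fin.cases ?_ (fun i => ?_) i <;> simp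

theorem M_pow_wrd (d : ℕ) (k a : Fin d → ℕ) (m a0 : ℕ) :
    (M ^ m) (wB (List.replicate a0 0 ++ wrd d k a)) =
    ∑ e ∈ Finset.Nat.antidiagonalTuple (d + 1) m,
      ((m.factorial * ((a0 + e 0).choose (e 0) *
        ∏ i : Fin d, (a i + e i.succ).choose (e i.succ)) : ℕ) : ℚ) •
        wB (List.replicate (a0 + e 0) 0 ++ wrd d k (fun i => a i + e i.succ)) := by
  induction d generalizing m a0 with
  | zero =>
    have : ∀ b : Fin 0 → ℕ, wrd 0 k b = [] := fun b => by simp [wrd]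
    simp only [this, ← con0_pow_wB, M_pow_nil]
    simp
  | succ d ih =>
    rw [wrd_succ, ← con0_pow_wB, ← conL_wB, M_pow_con, sum_tuple_succ]
    refine Finset.sum_congr rfl fun pq hpq => ?_
    rw [Finset.HasAntidiagonal.mem_antidiagonal] at hpq
    rw [ih, map_sum, map_sum, Finset.smul_sum]
    refine Finset.sum_congr rfl fun e _ => ?_
    rw [map_smul, map_smul, smul_smul, conL_wB, con0_pow_wB]
    simp only [Fin.cons_zero, Fin.cons_succ, wrd_succ]
    congr 1
    simp only [Fin.prod_univ_succ, Fin.cons_zero, Fin.cons_succ]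
    have h : m.choose pq.1 * pq.1.factorial * pq.2.factorial = m.factorial := by
      rw [← hpq, Nat.choose_symm_add]; exact Nat.add_choose_mul_factorial_mul_factorial _ _
    rw [← h]
    push_cast
    ring

theorem sum_matSet_succ {V : Type*} [AddCommMonoid V] (d : ℕ) (m : Fin (d + 1) → ℕ)
    (F : (Fin (d + 1) → Fin (d + 1) → ℕ) → V) :
    ∑ c ∈ matSet (d + 1) m, F c =
    ∑ c ∈ matSet d (fun j => m j.succ), ∑ e ∈ Finset.Nat.antidiagonalTuple (d + 1) (m 0),
      F (Fin.cons e (fun j => Fin.cons 0 (c j))) := by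
  rw [← Finset.sum_product']
  refine Finset.sum_bij' (fun c _ => (fun j i => c j.succ i.succ, c 0))
    (fun x _ => Fin.cons x.2 (fun j => Fin.cons 0 (x.1 j))) ?_ ?_ ?_ ?_ ?_
  · intro c hc
    simp only [matSet, Finset.mem_filter, Fintype.mem_piFinset,
      Finset.Nat.mem_antidiagonalTuple, Finset.mem_product] at hc ⊢
    refine ⟨⟨fun j => ?_, fun i j h => hc.2 _ _ (Fin.succ_lt_succ_iff.2 h)⟩, hc.1 0⟩
    have := hc.1 j.succ
    rwa [Fin.sum_univ_succ, hc.2 0 j.succ (Fin.succ_pos j), zero_add] at this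
  · rintro ⟨c, e⟩ h
    simp only [matSet, Finset.mem_filter, Fintype.mem_piFinset,
      Finset.Nat.mem_antidiagonalTuple, Finset.mem_product] at h ⊢
    refine ⟨fun j => ?_, fun i j => ?_⟩
    · refine Fin.cases ?_ (fun j => ?_) j
      · simpa using h.2
      · simpa [Fin.sum_univ_succ] using h.1.1 j
    · refine Fin.cases ?_ (fun j => ?_) j
      · intro h'; exact absurd h' (Fin.not_lt_zero i)
      · refine Fin.cases ?_ (fun i => ?_) i
        · simp
        · intro h'
          simpa using h.1.2 i j (Fin.succ_lt_succ_iff.1 h')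
  · intro c hc
    simp only [matSet, Finset.mem_filter] at hc
    funext j i
    refine Fin.cases ?_ (fun j => ?_) j
    · simp
    · refine Fin.cases ?_ (fun i => ?_) i
      · simp [hc.2 0 j.succ (Fin.succ_pos j)]
      · simp
  · rintro ⟨c, e⟩ h
    simp
  · intro c hc
    simp only [matSet, Finset.mem_filter] at hc
    congr 1
    funext j i
    refine Fin.cases ?_ (fun j => ?_) j
    · simp
    · refine Fin.cases ?_ (fun i => ?_) i
      · simp [hc.2 0 j.succ (Fin.succ_pos j)]
      · simp

theorem multinomial_succ (d : ℕ) (f : Fin (d + 1) → ℕ) : Nat.multinomial Finset.univ f =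
    (∑ j : Fin d, f j.succ + f 0).choose (f 0) *
      Nat.multinomial Finset.univ (fun j : Fin d => f j.succ) := by
  have h1 := Nat.multinomial_spec Finset.univ f
  have h2 := Nat.multinomial_spec Finset.univ (fun j : Fin d => f j.succ)
  rw [Fin.prod_univ_succ, Fin.sum_univ_succ] at h1
  have h3 := Nat.add_choose_mul_factorial_mul_factorial (f 0) (∑ j : Fin d, f j.succ)
  rw [add_comm (f 0) (∑ j : Fin d, f j.succ), ← h2] at h3
  rw [add_comm (f 0) (∑ j : Fin d, f j.succ), ← h3] at h1
  have hp : 0 < (f 0).factorial * ∏ j : Fin d, (f j.succ).factorial :=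
    Nat.mul_pos (Nat.factorial_pos _) (Finset.prod_pos fun _ _ => Nat.factorial_pos _)
  apply Nat.eq_of_mul_eq_mul_left hp
  rw [h1, Nat.choose_symm_add]
  ring

/-- `φ_#` with the word given by functions -/
noncomputable def phiF (d : ℕ) (k m : Fin d → ℕ) : QB :=
  ∑ c ∈ matSet d m,
    ((∏ j : Fin d, ((m j).factorial : ℚ)) *
        ∏ i : Fin d, (Nat.multinomial Finset.univ (fun j => c j i) : ℚ)) •
      wB (wrd d k fun i => ∑ j : Fin d, c j i)

theorem phiF_succ (d : ℕ) (k m : Fin (d + 1) → ℕ) : phiF (d + 1) k m =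
    conL (k 0 + 1) ((M ^ (m 0)) (phiF d (fun i => k i.succ) (fun i => m i.succ))) := by
  rw [phiF, phiF, sum_matSet_succ, map_sum, map_sum]
  refine Finset.sum_congr rfl fun c _ => ?_
  rw [map_smul, map_smul]
  have h := M_pow_wrd d (fun i => k i.succ) (fun i => ∑ j : Fin d, c j i) (m 0) 0
  rw [List.replicate_zero, List.nil_append] at h
  rw [h, map_sum, Finset.smul_sum]
  refine Finset.sum_congr rfl fun e _ => ?_
  rw [map_smul, smul_smul, conL_wB, wrd_succ]
  simp only [Fin.sum_univ_succ, Fin.prod_univ_succ, Fin.cons_zero, Fin.cons_succ,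
    multinomial_succ, Finset.sum_const_zero, add_zero, zero_add, Nat.choose_self, one_mul]
  have h0 : Nat.multinomial (Finset.univ : Finset (Fin d)) (fun _ => 0) = 1 := by
    simp [Nat.multinomial]
  rw [h0]
  congr 1
  · push_cast
    rw [Finset.prod_mul_distrib]
    ring
  · simp only [add_comm]

theorem phiW_eq (w : List (ℕ × ℕ)) : phiW w = psi w := by
  have h : ∀ w, phiW w = phiF w.length (fun i => (w.get i).1) (fun i => (w.get i).2) :=
    fun w => rfl
  rw [h]
  induction w with
  | nil =>
    simp [phiF, psi, wrd, matSet]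
  | cons p w ih =>
    rw [psi, ← ih]
    exact phiF_succ w.length _ _

theorem phi_wY (w : List (ℕ × ℕ)) : phi (wY w) = psi w := by
  simp [phi, wY, phiW_eq]

theorem dec0_phi (x : QY) : dec0 (phi x) = x.sum fun w a => a • dec0 (psi w) := by
  simp only [phi, dec0_eq, Finsupp.sum, map_sum, map_smul, phiW_eq]

/-- `(φ_# ⊗ φ_#) ∘ Δ_dec = Δ_dec⁰ ∘ φ_#` on `ℚ⟨Y^bi⟩`. -/
theorem phi_sharp_intertwines_coproducts :
    ∀ x : QY,
      (x.sum fun w a =>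
        a • ∑ i ∈ Finset.range (w.length + 1),
          (phi (wY (w.take i))) ⊗ₜ[ℚ] (phi (wY (w.drop i))))
      = dec0 (phi x) := by
  intro x
  simp only [phi_wY, dec0_phi, dec0_psi]
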